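/- For every coloring f : FIN_A → C into a finite set C, there exists a uniformly recurrent coloring g : FIN_A → C that is weakly proximal to f. -/

import Mathlib

namespace Carlson

/-- The domain of a partial function `ℕ →. B`, encoded as `ℕ → Option B`. -/
def dom {B : Type*} (p : ℕ → Option B) : Set ℕ := {n | p n ≠ none}

/-- `p` is a located word over `B`: a partial function with finite nonempty domain. -/
def IsLW {B : Type*} (p : ℕ → Option B) : Prop := (dom p).Finite ∧ (dom p).Nonempty

/-- A located variable word over `A` is a located word over `Option A`
(where `none` encodes the variable `⋆`) taking the value `⋆` at least once. -/
def IsLVW {A : Type*} (p : ℕ → Option (Option A)) : Prop :=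
  IsLW p ∧ ∃ n, p n = some none

/-- `p < q`: every element of the domain of `p` is below every element of the domain of `q`. -/
def blt {B : Type*} (p q : ℕ → Option B) : Prop :=
  ∀ m ∈ dom p, ∀ n ∈ dom q, m < n

/-- Union `p ∪ q` of two partial functions (`p` takes precedence; for `blt p q`
the domains are disjoint, so this is the genuine union). -/
def pun {B : Type*} (p q : ℕ → Option B) : ℕ → Option B :=
  fun n => (p n).elim (q n) some

/-- The empty partial function. -/
def emptyW {B : Type*} : ℕ → Option B := fun _ => none

/-- `p[a]`: substitution of the letter `a ∈ A` for the variable `⋆` in a located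
variable word. -/
def substA {A : Type*} (p : ℕ → Option (Option A)) (a : A) : ℕ → Option A :=
  fun n => (p n).map fun x => x.getD a

/-- `p[a]` for `a ∈ A ∪ {⋆}` (with `none` encoding `⋆`, so `p[⋆] = p`). -/
def substV {A : Type*} (p : ℕ → Option (Option A)) (a : Option A) : ℕ → Option (Option A) :=
  fun n => (p n).map fun x => x.elim a some

/-- Union of a finite family of partial functions with pairwise disjoint domains. -/
def famUnion {B : Type*} {k : ℕ} (g : Fin k → ℕ → Option B) : ℕ → Option B :=
  fun n => ((List.ofFn fun i => g i n).filterMap id).head?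

/-- A block sequence: a set of located variable words totally ordered by `<`. -/
def IsBlockSeq {A : Type*} (X : Set (ℕ → Option (Option A))) : Prop :=
  (∀ p ∈ X, IsLVW p) ∧ ∀ p ∈ X, ∀ q ∈ X, p = q ∨ blt p q ∨ blt q p

/-- `[X]_A`: located words of the form `p₀[a₀] ∪ ⋯ ∪ p_k[a_k]` with `p₀ < ⋯ < p_k`
all in `X` and `a₀, …, a_k ∈ A`. -/
def combA {A : Type*} (X : Set (ℕ → Option (Option A))) : Set (ℕ → Option A) :=
  { q | ∃ (k : ℕ) (p : Fin (k + 1) → ℕ → Option (Option A)) (a : Fin (k + 1) → A),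
      (∀ i, p i ∈ X) ∧ (∀ i j : Fin (k + 1), i < j → blt (p i) (p j)) ∧
      q = famUnion fun i => substA (p i) (a i) }

/-- `[X]_{A⋆}`: located variable words of the form `p₀[a₀] ∪ ⋯ ∪ p_k[a_k]` with
`p₀ < ⋯ < p_k` all in `X`, `a₀, …, a_k ∈ A ∪ {⋆}`, and `⋆` used at least once. -/
def combV {A : Type*} (X : Set (ℕ → Option (Option A))) : Set (ℕ → Option (Option A)) :=
  { q | ∃ (k : ℕ) (p : Fin (k + 1) → ℕ → Option (Option A)) (a : Fin (k + 1) → Option A),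
      (∀ i, p i ∈ X) ∧ (∀ i j : Fin (k + 1), i < j → blt (p i) (p j)) ∧
      (∃ i, a i = none) ∧ q = famUnion fun i => substV (p i) (a i) }

/-- `X − F`: the elements of `X` whose domain lies entirely above the domains of
all members of `F`. -/
def sminus {B : Type*} (X F : Set (ℕ → Option B)) : Set (ℕ → Option B) :=
  { q ∈ X | ∀ p ∈ F, blt p q }

/-- `dom q ⊆ [0, ℓ)`. -/
def domBelow {B : Type*} (q : ℕ → Option B) (ℓ : ℕ) : Prop := ∀ n ∈ dom q, n < ℓ

/-- `dom q ⊆ [m, ∞)`. -/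
def domAbove {B : Type*} (q : ℕ → Option B) (m : ℕ) : Prop := ∀ n ∈ dom q, m ≤ n

/-- `S^ℓ_p(f) = S^ℓ_{p'}(g)` for colorings of located words: agreement at `q ∪ p`
vs `q ∪ p'` for every located word `q` with domain contained in `[0, ℓ)`.
(Take `p' = emptyW` to express `S^ℓ_p(f) = S^ℓ(g)`.) -/
def SEq {A C : Type*} (f g : (ℕ → Option A) → C) (ℓ : ℕ) (p p' : ℕ → Option A) : Prop :=
  ∀ q : ℕ → Option A, IsLW q → domBelow q ℓ → f (pun q p) = g (pun q p')

/-- Variant of `SEq` for colorings that are also defined at the empty located word,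
i.e. `q` ranges over `FIN_A(0, ℓ) ∪ {∅}`. -/
def SEq0 {A C : Type*} (f g : (ℕ → Option A) → C) (ℓ : ℕ) (p p' : ℕ → Option A) : Prop :=
  ∀ q : ℕ → Option A, (dom q).Finite → domBelow q ℓ → f (pun q p) = g (pun q p')

/-- A coloring `f` is recurrent if for every `ℓ` there is a located variable word `p`
with domain in `[ℓ, ∞)` such that `S^ℓ_{p[a]}(f) = S^ℓ(f)` for every `a ∈ A`. -/
def Recurrent {A C : Type*} (f : (ℕ → Option A) → C) : Prop :=
  ∀ ℓ : ℕ, ∃ p : ℕ → Option (Option A), IsLVW p ∧ domAbove p ℓ ∧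
    ∀ a : A, SEq f f ℓ (substA p a) emptyW

/-- A coloring `f` is uniformly recurrent if for every `ℓ` there is `m > ℓ` such that
for every `p ∈ FIN_A(m, ∞)` there is `q ∈ FIN_A(ℓ, m)` with `S^ℓ_{q ∪ p}(f) = S^ℓ(f)`. -/
def UnifRecurrent {A C : Type*} (f : (ℕ → Option A) → C) : Prop :=
  ∀ ℓ : ℕ, ∃ m : ℕ, ℓ < m ∧ ∀ p : ℕ → Option A, IsLW p → domAbove p m →
    ∃ q : ℕ → Option A, IsLW q ∧ domAbove q ℓ ∧ domBelow q m ∧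
      SEq f f ℓ (pun q p) emptyW

/-- `f` and `g` are weakly proximal: for every `ℓ` there is `p ∈ FIN_A(ℓ, ∞)` with
`S^ℓ_p(f) = S^ℓ_p(g)`. -/
def WeakProx {A C : Type*} (f g : (ℕ → Option A) → C) : Prop :=
  ∀ ℓ : ℕ, ∃ p : ℕ → Option A, IsLW p ∧ domAbove p ℓ ∧ SEq f g ℓ p p

/-- `g` is strongly proximal to `f`: for every `ℓ` there is a located variable word `p`
with domain in `[ℓ, ∞)` such that `S^ℓ(g) = S^ℓ_{p[a]}(g) = S^ℓ_{p[a]}(f)` for all `a ∈ A`. -/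
def StrongProx {A C : Type*} (g f : (ℕ → Option A) → C) : Prop :=
  ∀ ℓ : ℕ, ∃ p : ℕ → Option (Option A), IsLVW p ∧ domAbove p ℓ ∧
    ∀ a : A, SEq g g ℓ emptyW (substA p a) ∧ SEq g f ℓ (substA p a) (substA p a)

/-- `Recurrent` for colorings also defined at the empty located word. -/
def Recurrent0 {A C : Type*} (f : (ℕ → Option A) → C) : Prop :=
  ∀ ℓ : ℕ, ∃ p : ℕ → Option (Option A), IsLVW p ∧ domAbove p ℓ ∧
    ∀ a : A, SEq0 f f ℓ (substA p a) emptyW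

/-- `StrongProx` for colorings also defined at the empty located word. -/
def StrongProx0 {A C : Type*} (g f : (ℕ → Option A) → C) : Prop :=
  ∀ ℓ : ℕ, ∃ p : ℕ → Option (Option A), IsLVW p ∧ domAbove p ℓ ∧
    ∀ a : A, SEq0 g g ℓ emptyW (substA p a) ∧ SEq0 g f ℓ (substA p a) (substA p a)

/-- Agreement of two colorings on all located words with domain in `[0, ℓ)`. -/
def AgreeBelow {A C : Type*} (f g : (ℕ → Option A) → C) (ℓ : ℕ) : Prop :=
  ∀ q : ℕ → Option A, IsLW q → domBelow q ℓ → f q = g q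

/-- Closedness of a class in `C^{FIN_A}` with the product topology (`C` discrete):
a class is closed iff it contains every coloring all of whose finite restrictions
(to located words with domain in `[0, ℓ)`, for each `ℓ`) are matched within the class. -/
def IsClosedColl {A C : Type*} (𝓒 : Set ((ℕ → Option A) → C)) : Prop :=
  ∀ f, (∀ ℓ : ℕ, ∃ g ∈ 𝓒, AgreeBelow f g ℓ) → f ∈ 𝓒

/-- A subshift: a nonempty closed class `𝓒 ⊆ C^{FIN_A}` such that for every `f ∈ 𝓒`,
`ℓ ∈ ℕ` and `p ∈ FIN_A(ℓ, ∞)` there is `g ∈ 𝓒` with `S^ℓ(g) = S^ℓ_p(f)`. -/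
def IsSubshift {A C : Type*} (𝓒 : Set ((ℕ → Option A) → C)) : Prop :=
  𝓒.Nonempty ∧ IsClosedColl 𝓒 ∧
    ∀ f ∈ 𝓒, ∀ ℓ : ℕ, ∀ p : ℕ → Option A, IsLW p → domAbove p ℓ →
      ∃ g ∈ 𝓒, SEq g f ℓ emptyW p

/-- A minimal subshift: no subshift is a proper subset of it. -/
def IsMinimalSubshift {A C : Type*} (𝓒 : Set ((ℕ → Option A) → C)) : Prop :=
  IsSubshift 𝓒 ∧ ∀ 𝓓 : Set ((ℕ → Option A) → C), IsSubshift 𝓓 → 𝓓 ⊆ 𝓒 → 𝓓 = 𝓒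

/-- The orbit closure of a coloring `f`: all `g` such that for every `ℓ` and every
`q ∈ FIN_A(ℓ, ∞)` there is `p ∈ FIN_A(ℓ, ∞)` with `S^ℓ_q(g) = S^ℓ_p(f)`. -/
def orbCl {A C : Type*} (f : (ℕ → Option A) → C) : Set ((ℕ → Option A) → C) :=
  { g | ∀ ℓ : ℕ, ∀ q : ℕ → Option A, IsLW q → domAbove q ℓ →
      ∃ p : ℕ → Option A, IsLW p ∧ domAbove p ℓ ∧ SEq g f ℓ q p }

/-- A variable word over `A`, encoded as a list over `Option A` with `none` = `⋆`:
the variable must occur at least once. -/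
def IsVarWord {A : Type*} (w : List (Option A)) : Prop := none ∈ w

/-- `w[a]`: replace every occurrence of the variable `⋆` by the letter `a`. -/
def substW {A : Type*} (w : List (Option A)) (a : A) : List A :=
  w.map fun x => x.getD a

/-- `⟨(w_n)_{n∈ℕ}⟩_A`: the words `w_{j₀}[a₀] ⋯ w_{j_{k-1}}[a_{k-1}]` extracted from
the sequence `(w_n)`, for `j₀ < ⋯ < j_{k-1}` and letters `a₀, …, a_{k-1} ∈ A`. -/
def extracted {A : Type*} (w : ℕ → List (Option A)) : Set (List A) :=
  { u | ∃ (k : ℕ) (j : Fin (k + 1) → ℕ) (a : Fin (k + 1) → A),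
      StrictMono j ∧ u = (List.ofFn fun i => substW (w (j i)) (a i)).flatten }

open Filter

/-- In a compact right topological semigroup, every nonempty closed subsemigroup `s` contains an
idempotent `u` which is minimal: `u ∈ s * v * u` for every `v ∈ s`. -/
theorem exists_minimal_idempotent {M : Type*} [Semigroup M] [TopologicalSpace M] [T2Space M]
    (hcont : ∀ r : M, Continuous (· * r)) (s : Set M) (hne : s.Nonempty) (hs : IsCompact s)
    (hmul : ∀ x ∈ s, ∀ y ∈ s, x * y ∈ s) :
    ∃ u ∈ s, u * u = u ∧ ∀ v ∈ s, ∃ w ∈ s, w * v * u = u := by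
  let I : Set (Set M) :=
    {L | L ⊆ s ∧ L.Nonempty ∧ IsCompact L ∧ ∀ x ∈ s, ∀ y ∈ L, x * y ∈ L}
  obtain ⟨L, -, hL⟩ := zorn_superset_nonempty I (fun c hc hchain hcne => by
    have : Nonempty c := hcne.to_subtype
    refine ⟨⋂₀ c, ⟨?_, ?_, ?_, ?_⟩, fun t ht => Set.sInter_subset_of_mem ht⟩
    · obtain ⟨t, ht⟩ := hcne
      exact (Set.sInter_subset_of_mem ht).trans (hc ht).1
    · exact IsCompact.nonempty_sInter_of_directed_nonempty_isCompact_isClosed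
        (fun x hx y hy => (hchain.total hx hy).elim (fun h => ⟨x, hx, subset_rfl, h⟩)
          fun h => ⟨y, hy, h, subset_rfl⟩) (fun t ht => (hc ht).2.1)
        (fun t ht => (hc ht).2.2.1) (fun t ht => (hc ht).2.2.1.isClosed)
    · obtain ⟨t, ht⟩ := hcne
      exact (hc ht).2.2.1.of_isClosed_subset
        (isClosed_sInter fun t ht => (hc ht).2.2.1.isClosed) (Set.sInter_subset_of_mem ht)
    · exact fun x hx y hy t ht => (hc ht).2.2.2 x hx y (hy t ht))
    s ⟨subset_rfl, hne, hs, hmul⟩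
  obtain ⟨hLs, hLne, hLc, hLm⟩ := hL.prop
  obtain ⟨u, hu, huu⟩ := exists_idempotent_in_compact_subsemigroup hcont L hLne hLc
    (fun x hx y hy => hLm x (hLs hx) y hy)
  refine ⟨u, hLs hu, huu, fun v hv => ?_⟩
  have hvu : v * u ∈ L := hLm v hv u hu
  have hsub : (· * (v * u)) '' s ⊆ L := by
    rintro _ ⟨x, hx, rfl⟩
    exact hLm x hx _ hvu
  have hI : (· * (v * u)) '' s ∈ I := by
    refine ⟨hsub.trans hLs, hne.image _, hs.image (hcont _), ?_⟩
    rintro x hx _ ⟨y, hy, rfl⟩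
    exact ⟨x * y, hmul x hx y hy, mul_assoc _ _ _⟩
  obtain ⟨w, hw, hwu⟩ := hL.le_of_le hI hsub hu
  exact ⟨w, hw, by simpa [mul_assoc] using hwu⟩

/-- Partial functions form a semigroup under left-biased union. -/
abbrev punSemigroup (B : Type*) : Semigroup (ℕ → Option B) where
  mul := pun
  mul_assoc p q r := by
    funext n
    change pun (pun p q) r n = pun p (pun q r) n
    unfold pun
    cases p n <;> rfl

attribute [local instance] punSemigroup Ultrafilter.semigroup

theorem dom_pun {B : Type*} (p q : ℕ → Option B) : dom (pun p q) = dom p ∪ dom q := by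
  ext n
  simp only [dom, pun, Set.mem_union, Set.mem_ofPred_eq]
  cases p n <;> simp

theorem pun_emptyW {B : Type*} (p : ℕ → Option B) : pun p emptyW = p := by
  funext n
  simp only [pun, emptyW]
  cases p n <;> rfl

theorem finite_domBelow (A : Type*) [Finite A] (ℓ : ℕ) :
    {q : ℕ → Option A | domBelow q ℓ}.Finite := by
  refine Set.Finite.of_injOn (f := fun q (i : Fin ℓ) => q i) (t := Set.univ)
    (fun _ _ => Set.mem_univ _) ?_ Set.finite_univ
  intro p hp q hq hpq
  funext n
  by_cases hn : n < ℓ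
  · exact congrFun hpq ⟨n, hn⟩
  · have h : ∀ r : ℕ → Option A, domBelow r ℓ → r n = none := fun r hr => by
      by_contra h
      exact hn (hr n h)
    rw [h p hp, h q hq]

/-- The ultrafilters on partial functions that concentrate on located words supported
arbitrarily far out. -/
def cofinalUltrafilters (B : Type*) : Set (Ultrafilter (ℕ → Option B)) :=
  {U | ∀ ℓ, ∀ᶠ p in (U : Filter (ℕ → Option B)), IsLW p ∧ domAbove p ℓ}

theorem isCompact_cofinalUltrafilters (B : Type*) : IsCompact (cofinalUltrafilters B) := by
  have h : cofinalUltrafilters B =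
      ⋂ ℓ, {U : Ultrafilter (ℕ → Option B) | {p | IsLW p ∧ domAbove p ℓ} ∈ U} := by
    ext U
    simp [cofinalUltrafilters, Filter.Eventually]
  rw [h]
  exact (isClosed_iInter fun ℓ => ultrafilter_isClosed_basic _).isCompact

theorem mul_mem_cofinalUltrafilters {B : Type*} {U V : Ultrafilter (ℕ → Option B)}
    (hU : U ∈ cofinalUltrafilters B) (hV : V ∈ cofinalUltrafilters B) :
    U * V ∈ cofinalUltrafilters B := by
  intro ℓ
  rw [Ultrafilter.eventually_mul]
  filter_upwards [hU ℓ] with p hp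
  filter_upwards [hV ℓ] with q hq
  change IsLW (pun p q) ∧ domAbove (pun p q) ℓ
  rw [IsLW, domAbove, dom_pun]
  exact ⟨⟨hp.1.1.union hq.1.1, hp.1.2.inl⟩, fun n hn => hn.elim (hp.2 n) (hq.2 n)⟩

theorem map_mem_cofinalUltrafilters {B : Type*} {p : ℕ → ℕ → Option B}
    (hp : ∀ m, IsLW (p m) ∧ domAbove (p m) m) :
    (hyperfilter ℕ).map p ∈ cofinalUltrafilters B := by
  intro ℓ
  rw [Ultrafilter.coe_map, eventually_map]
  filter_upwards [Nat.hyperfilter_le_atTop (eventually_ge_atTop ℓ)] with m hm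
  exact ⟨(hp m).1, fun n hn => le_trans hm ((hp m).2 n hn)⟩

theorem nonempty_cofinalUltrafilters (B : Type*) [Nonempty B] :
    (cofinalUltrafilters B).Nonempty := by
  obtain ⟨b⟩ := ‹Nonempty B›
  refine ⟨_, map_mem_cofinalUltrafilters (p := fun m n => if n = m then some b else none)
    fun m => ?_⟩
  have h : dom (fun n => if n = m then some b else none) = {m} := by
    ext n
    simp [dom]
  rw [IsLW, domAbove, h]
  simp

/-- The limit of `q ↦ f (q ∪ p)` as `p` tends to an ultrafilter. -/
theorem exists_ultrafilter_limit {A C : Type*} [Finite C] (f : (ℕ → Option A) → C)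
    (U : Ultrafilter (ℕ → Option A)) :
    ∃ g : (ℕ → Option A) → C, ∀ q, ∀ᶠ p in U, f (pun q p) = g q := by
  suffices h : ∀ q, ∃ c, ∀ᶠ p in U, f (pun q p) = c from Classical.skolem.1 h
  intro q
  obtain ⟨c, hc⟩ := (U.map fun p => f (pun q p)).eq_pure_of_finite
  refine ⟨c, ?_⟩
  have h : ∀ᶠ x in (U.map fun p => f (pun q p)), x = c := by
    rw [hc]
    exact eventually_pure.2 rfl
  exact h

theorem eventually_limit_pun_eq {A C : Type*} {f g : (ℕ → Option A) → C}
    {U V : Ultrafilter (ℕ → Option A)} (hg : ∀ q, ∀ᶠ p in U, f (pun q p) = g q)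
    (hVU : V * U = U) (q : ℕ → Option A) : ∀ᶠ p in V, g (pun q p) = g q := by
  have h := hg q
  rw [← hVU, Ultrafilter.eventually_mul] at h
  filter_upwards [h] with p hp
  obtain ⟨r, hr, hr'⟩ := (hp.and (hg (pun q p))).exists
  rw [← hr, ← hr']
  exact congrArg f (mul_assoc q p r)

theorem unifRecurrent_of_eventually {A C : Type*} [Finite A] {g : (ℕ → Option A) → C}
    (h : ∀ V ∈ cofinalUltrafilters A, ∃ W ∈ cofinalUltrafilters A,
      ∀ t, ∀ᶠ p in ↑(W * V), g (pun t p) = g t) : UnifRecurrent g := by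
  intro ℓ
  by_contra! hcon
  have hbad : ∀ m, ∃ p : ℕ → Option A, (IsLW p ∧ domAbove p m) ∧ (ℓ < m →
      ∀ q, IsLW q → domAbove q ℓ → domBelow q m → ¬ SEq g g ℓ (pun q p) emptyW) := by
    intro m
    obtain ⟨p, hp, hpa, hq⟩ := hcon (max m (ℓ + 1)) (by omega)
    refine ⟨p, ⟨hp, fun n hn => (le_max_left _ _).trans (hpa n hn)⟩, fun hm => ?_⟩
    rwa [max_eq_left (by omega : ℓ + 1 ≤ m)] at hq
  choose p hp hbad using hbad
  obtain ⟨W, hW, hWV⟩ := h _ (map_mem_cofinalUltrafilters hp)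
  have hall := (eventually_all_finite (finite_domBelow A ℓ)).2 fun t _ => hWV t
  rw [Ultrafilter.eventually_mul] at hall
  obtain ⟨q, hq, hqW, hqa⟩ := (hall.and (hW ℓ)).exists
  rw [Ultrafilter.coe_map, eventually_map] at hq
  obtain ⟨N, hN⟩ := hqW.1.bddAbove
  have hlarge : ∀ᶠ m in (hyperfilter ℕ : Filter ℕ), N < m ∧ ℓ < m :=
    Nat.hyperfilter_le_atTop ((eventually_gt_atTop N).and (eventually_gt_atTop ℓ))
  obtain ⟨m, hm, hmN, hmℓ⟩ := (hq.and hlarge).exists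
  refine hbad m hmℓ q hqW hqa (fun n hn => (hN hn).trans_lt hmN) fun t _ ht => ?_
  rw [pun_emptyW]
  exact hm t ht

/-- Auslander–Ellis theorem for `C^{FIN_A}`: for every coloring `f : FIN_A → C` there is
a uniformly recurrent coloring `g : FIN_A → C` weakly proximal to `f`. -/
theorem auslander_ellis_located_words {A C : Type*} [Fintype A] [Nonempty A] [Fintype C]
    (f : (ℕ → Option A) → C) :
    ∃ g : (ℕ → Option A) → C, UnifRecurrent g ∧ WeakProx g f := by
  obtain ⟨U, hU, hUU, hmin⟩ := exists_minimal_idempotent Ultrafilter.continuous_mul_left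
    (cofinalUltrafilters A) (nonempty_cofinalUltrafilters A) (isCompact_cofinalUltrafilters A)
    fun _ hx _ hy => mul_mem_cofinalUltrafilters hx hy
  obtain ⟨g, hg⟩ := exists_ultrafilter_limit f U
  refine ⟨g, unifRecurrent_of_eventually fun V hV => ?_, fun ℓ => ?_⟩
  · obtain ⟨W, hW, hWVU⟩ := hmin V hV
    exact ⟨W, hW, eventually_limit_pun_eq hg hWVU⟩
  · have hall := (eventually_all_finite (finite_domBelow A ℓ)).2 fun t _ =>
      (eventually_limit_pun_eq hg hUU t).and (hg t)
    obtain ⟨p, hp, hpW, hpa⟩ := (hall.and (hU ℓ)).exists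
    exact ⟨p, hpW, hpa, fun q _ hq => (hp q hq).1.trans (hp q hq).2.symm⟩

end Carlson
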